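/- Let Λ be a set and let Γ be a subshift of Λ^ω. If Γ is a subshift of bounded type, then (Γ, σ) has the asymptotic shadowing property with respect to the metric d(x,y) = inf{2^{-n} : x_i = y_i for all i < n}. -/

import Mathlib

open Set Filter Topology

/-- The shift map `σ` on `ℕ → Λ`, defined by `σ(x)(n) = x(n+1)`. -/
def shift {Λ : Type*} (x : ℕ → Λ) : ℕ → Λ := fun n => x (n + 1)

/-- The Baire metric `d(x,y) = inf {2^{-n} : x_i = y_i for all i < n}`. -/
noncomputable def bDist {Λ : Type*} (x y : ℕ → Λ) : ℝ :=
  sInf {r : ℝ | ∃ n : ℕ, r = (2 : ℝ)⁻¹ ^ n ∧ ∀ i < n, x i = y i}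

/-- `Γ` is a subshift: a closed, shift-invariant subset of `ℕ → Λ`. -/
def IsSubshift {Λ : Type*} [TopologicalSpace Λ] (Γ : Set (ℕ → Λ)) : Prop :=
  IsClosed Γ ∧ shift '' Γ = Γ

/-- The finite word `w` is allowed in `Γ`: it occurs as a consecutive block in some point of `Γ`. -/
def Allowed {Λ : Type*} (Γ : Set (ℕ → Λ)) (w : List Λ) : Prop :=
  ∃ x ∈ Γ, ∃ i : ℕ, ∀ (j : ℕ) (h : j < w.length), x (i + j) = w.get ⟨j, h⟩

/-- `F` is a basis for the forbidden words of `Γ`: each member of `F` is forbidden, and every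
forbidden word contains a member of `F` as a consecutive (infix) subword. -/
def IsForbiddenBasis {Λ : Type*} (Γ : Set (ℕ → Λ)) (F : Set (List Λ)) : Prop :=
  (∀ w ∈ F, ¬ Allowed Γ w) ∧ ∀ w : List Λ, ¬ Allowed Γ w → ∃ v ∈ F, v <:+: w

/-- `Γ` is a subshift of finite type: it has a finite basis for its forbidden words. -/
def IsSFT {Λ : Type*} (Γ : Set (ℕ → Λ)) : Prop :=
  ∃ F : Set (List Λ), F.Finite ∧ IsForbiddenBasis Γ F

/-- `Γ` is a subshift of bounded type: it has a basis for its forbidden words whose members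
have uniformly bounded length. -/
def IsSBT {Λ : Type*} (Γ : Set (ℕ → Λ)) : Prop :=
  ∃ F : Set (List Λ), (∃ N : ℕ, ∀ w ∈ F, w.length ≤ N) ∧ IsForbiddenBasis Γ F

/-- `(Γ, σ)` has the asymptotic shadowing property w.r.t. the Baire metric. -/
def HasAsymptoticShadowing {Λ : Type*} (Γ : Set (ℕ → Λ)) : Prop :=
  ∀ x : ℕ → (ℕ → Λ), (∀ i, x i ∈ Γ) →
    Tendsto (fun i => bDist (shift (x i)) (x (i + 1))) atTop (𝓝 0) →
    ∃ z ∈ Γ, Tendsto (fun i => bDist (shift^[i] z) (x i)) atTop (𝓝 0)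

theorem bDist_le_of_forall_lt {Λ : Type*} {x y : ℕ → Λ} {n : ℕ} (h : ∀ i < n, x i = y i) :
    bDist x y ≤ (2 : ℝ)⁻¹ ^ n :=
  csInf_le ⟨0, by rintro r ⟨m, rfl, -⟩; positivity⟩ ⟨n, rfl, h⟩

theorem bDist_nonneg {Λ : Type*} (x y : ℕ → Λ) : 0 ≤ bDist x y :=
  Real.sInf_nonneg (by rintro r ⟨m, rfl, -⟩; positivity)

theorem eq_of_bDist_lt {Λ : Type*} {x y : ℕ → Λ} {n : ℕ} (h : bDist x y < (2 : ℝ)⁻¹ ^ n) :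
    ∀ i < n, x i = y i := by
  obtain ⟨r, ⟨m, rfl, hm⟩, hlt⟩ := exists_lt_of_csInf_lt (⟨1, 0, by simp⟩ : Set.Nonempty
    {r : ℝ | ∃ m : ℕ, r = (2 : ℝ)⁻¹ ^ m ∧ ∀ i < m, x i = y i}) h
  have hnm : n < m := (pow_lt_pow_iff_right_of_lt_one₀ (by norm_num) (by norm_num)).1 hlt
  exact fun i hi => hm i (hi.trans hnm)

theorem tendsto_bDist_zero_iff {Λ : Type*} {ι : Type*} {l : Filter ι} {u v : ι → ℕ → Λ} :
    Tendsto (fun i => bDist (u i) (v i)) l (𝓝 0) ↔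
      ∀ n : ℕ, ∀ᶠ i in l, ∀ k < n, u i k = v i k := by
  constructor
  · intro h n
    filter_upwards [h.eventually_lt_const (by positivity : (0 : ℝ) < (2 : ℝ)⁻¹ ^ n)] with i hi
    exact eq_of_bDist_lt hi
  · intro h
    refine tendsto_order.2 ⟨fun a ha => .of_forall fun i => ha.trans_le (bDist_nonneg _ _), ?_⟩
    intro ε hε
    obtain ⟨n, hn⟩ := exists_pow_lt_of_lt_one hε (by norm_num : (2 : ℝ)⁻¹ < 1)
    filter_upwards [h n] with i hi
    exact (bDist_le_of_forall_lt hi).trans_lt hn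

theorem shift_iterate_apply {Λ : Type*} (n : ℕ) (x : ℕ → Λ) (k : ℕ) :
    shift^[n] x k = x (n + k) := by
  induction n generalizing x with
  | zero => simp
  | succ n ih =>
    rw [Function.iterate_succ_apply, ih, shift]
    congr 1
    omega

theorem IsSubshift.image_iterate {Λ : Type*} [TopologicalSpace Λ] {Γ : Set (ℕ → Λ)}
    (hΓ : IsSubshift Γ) (n : ℕ) : shift^[n] '' Γ = Γ := by
  induction n with
  | zero => simp
  | succ n ih => rw [Function.iterate_succ, image_comp, hΓ.2, ih]

theorem IsSubshift.mem_of_allowed_prefixes {Λ : Type*} [TopologicalSpace Λ] {Γ : Set (ℕ → Λ)}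
    (hΓ : IsSubshift Γ) {y : ℕ → Λ}
    (h : ∀ n : ℕ, Allowed Γ (List.ofFn fun j : Fin n => y j)) : y ∈ Γ := by
  have happrox : ∀ n : ℕ, ∃ p ∈ Γ, ∀ j < n, p j = y j := by
    intro n
    obtain ⟨x, hx, i, hi⟩ := h n
    refine ⟨shift^[i] x, (hΓ.image_iterate i).subset (mem_image_of_mem _ hx), fun j hj => ?_⟩
    rw [shift_iterate_apply, hi j (by simpa using hj)]
    simp
  choose p hp hpy using happrox
  refine hΓ.1.mem_of_tendsto (b := atTop) (f := p) (tendsto_pi_nhds.2 fun k => ?_)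
    (.of_forall hp)
  refine tendsto_const_nhds.congr' ?_
  filter_upwards [eventually_gt_atTop k] with n hn
  exact (hpy n k hn).symm

/-- A point all of whose windows of length `N` occur as prefixes of points of a subshift with a
basis of forbidden words of length at most `N` belongs to that subshift. -/
theorem IsSubshift.mem_of_windows {Λ : Type*} [TopologicalSpace Λ] {Γ : Set (ℕ → Λ)}
    (hΓ : IsSubshift Γ) {F : Set (List Λ)} (hF : IsForbiddenBasis Γ F) {N : ℕ}
    (hN : ∀ w ∈ F, w.length ≤ N) {y : ℕ → Λ}
    (h : ∀ i, ∃ x ∈ Γ, ∀ j < N, x j = y (i + j)) : y ∈ Γ := by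
  refine hΓ.mem_of_allowed_prefixes fun n => ?_
  by_contra hn
  obtain ⟨v, hvF, s, t, hst⟩ := hF.2 _ hn
  obtain ⟨x, hx, hxy⟩ := h s.length
  refine hF.1 v hvF ⟨x, hx, 0, fun j hj => ?_⟩
  rw [zero_add, hxy j (hj.trans_le (hN v hvF))]
  have hget := congrArg (fun l : List Λ => l[s.length + j]?) hst
  have hlen := congrArg List.length hst
  simp only [List.length_append, List.length_ofFn] at hlen
  have hlt : s.length + j < n := by omega
  simpa [List.getElem?_append, List.getElem?_ofFn, hj, hlt] using hget.symm

theorem eq_diagonal_of_shift_eq {Λ : Type*} {x : ℕ → ℕ → Λ} {I n : ℕ}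
    (h : ∀ i ≥ I, ∀ k < n, shift (x i) k = x (i + 1) k) {i : ℕ} (hi : I ≤ i) {k : ℕ}
    (hk : k ≤ n) : x i k = x (i + k) 0 := by
  induction k generalizing i with
  | zero => rfl
  | succ k ih =>
    have hstep : x i (k + 1) = x (i + 1) k := h i hi k hk
    rw [hstep, ih (by omega) (by omega), add_assoc, add_comm 1 k]

/-- A subshift of bounded type has the asymptotic shadowing property. -/
theorem sbt_hasAsymptoticShadowing {Λ : Type*} [TopologicalSpace Λ] [DiscreteTopology Λ]
    (Γ : Set (ℕ → Λ)) (hΓ : IsSubshift Γ) (hSBT : IsSBT Γ) :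
    HasAsymptoticShadowing Γ := by
  obtain ⟨F, ⟨N, hN⟩, hF⟩ := hSBT
  intro x hx hpseudo
  rw [tendsto_bDist_zero_iff] at hpseudo
  obtain ⟨I, hI⟩ := eventually_atTop.1 (hpseudo N)
  have hy : (fun n => x (I + n) 0) ∈ Γ := hΓ.mem_of_windows hF hN fun i =>
    ⟨x (I + i), hx _, fun j hj => by
      rw [eq_diagonal_of_shift_eq hI (by omega) hj.le, add_assoc]⟩
  obtain ⟨z, hz, hzy⟩ := (hΓ.image_iterate I).superset hy
  refine ⟨z, hz, tendsto_bDist_zero_iff.2 fun n => ?_⟩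
  obtain ⟨J, hJ⟩ := eventually_atTop.1 (hpseudo n)
  filter_upwards [eventually_ge_atTop I, eventually_ge_atTop J] with i hIi hJi k hk
  obtain ⟨m, rfl⟩ := Nat.exists_eq_add_of_le hIi
  have hzm := congrFun hzy (m + k)
  rw [shift_iterate_apply] at hzm
  rw [shift_iterate_apply, eq_diagonal_of_shift_eq hJ hJi hk.le, add_assoc, hzm]
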